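/- Let d_A, d_B ≥ 1 and D = min{d_A, d_B}. Then there exists a D²-outcome POVM M on ℂ^{d_A} ⊗ ℂ^{d_B} ≅ ℂ^{d_A d_B} such that R_Sep(M) ≥ D − 1, where Sep is the set of D²-outcome separable POVMs. -/

import Mathlib

open scoped BigOperators ComplexOrder Kronecker

/-- A POVM with outcome set `κ` on the Hilbert space with orthonormal basis indexed by `ι`:
a tuple of positive semidefinite matrices summing to `1`. -/
def IsPOVM {ι κ : Type*} [Fintype ι] [DecidableEq ι] [Fintype κ]
    (M : κ → Matrix ι ι ℂ) : Prop :=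
  (∀ k, (M k).PosSemidef) ∧ ∑ k, M k = 1

/-- A separable operator on `ℂ^{d_A} ⊗ ℂ^{d_B}`: a finite sum of Kronecker products of
positive semidefinite operators. -/
def IsSepMat {dA dB : ℕ} (X : Matrix (Fin dA × Fin dB) (Fin dA × Fin dB) ℂ) : Prop :=
  ∃ (k : ℕ) (A : Fin k → Matrix (Fin dA) (Fin dA) ℂ) (B : Fin k → Matrix (Fin dB) (Fin dB) ℂ),
    (∀ i, (A i).PosSemidef) ∧ (∀ i, (B i).PosSemidef) ∧ X = ∑ i, A i ⊗ₖ B i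

/-- The set of admissible noise parameters `s ≥ 0` for which some POVM `N` makes
`(M + s N)/(1+s)` a member of `F`. -/
def robustnessSet {ι κ : Type*} [Fintype ι] [DecidableEq ι] [Fintype κ]
    (F : Set (κ → Matrix ι ι ℂ)) (M : κ → Matrix ι ι ℂ) : Set ℝ :=
  {s : ℝ | 0 ≤ s ∧ ∃ N, IsPOVM N ∧
    (fun k => (1 + s)⁻¹ • (M k + s • N k)) ∈ F}

/-- The robustness of `M` with respect to `F`. -/
noncomputable def robustness {ι κ : Type*} [Fintype ι] [DecidableEq ι] [Fintype κ]
    (F : Set (κ → Matrix ι ι ℂ)) (M : κ → Matrix ι ι ℂ) : ℝ :=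
  sInf (robustnessSet F M)

/-- The set of separable POVMs with `D²` outcomes on `ℂ^{d_A} ⊗ ℂ^{d_B}`. -/
def SepPOVM (dA dB m : ℕ) : Set (Fin m → Matrix (Fin dA × Fin dB) (Fin dA × Fin dB) ℂ) :=
  {N | IsPOVM N ∧ ∀ i, IsSepMat (N i)}

open Matrix ComplexConjugate

/-- The off-diagonal entries of a positive semidefinite matrix are bounded by the geometric mean
of the corresponding diagonal entries. -/
lemma Matrix.PosSemidef.norm_apply_le_sqrt_mul_sqrt {ι : Type*} {A : Matrix ι ι ℂ}
    (hA : A.PosSemidef) (i j : ι) : ‖A i j‖ ≤ √(A i i).re * √(A j j).re := by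
  have hi := Complex.nonneg_iff.1 (hA.diag_nonneg (i := i))
  have hj := Complex.nonneg_iff.1 (hA.diag_nonneg (i := j))
  have hdet := (hA.submatrix ![i, j]).det_nonneg
  have hji : A j i = conj (A i j) := (hA.isHermitian.apply j i).symm
  rw [Matrix.det_fin_two] at hdet
  simp only [submatrix_apply, cons_val_zero, cons_val_one, hji, Complex.mul_conj,
    Complex.normSq_eq_norm_sq] at hdet
  have hre := (Complex.nonneg_iff.1 hdet).1
  rw [Complex.sub_re, Complex.mul_re, Complex.ofReal_re, ← hi.2, ← hj.2] at hre
  rw [← Real.sqrt_mul hi.1]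
  exact Real.le_sqrt_of_sq_le (by linarith)

/-- The sum of the entrywise products of two positive semidefinite matrices is bounded by the
product of their traces. -/
lemma Matrix.PosSemidef.sum_norm_mul_norm_le {ι : Type*} [Fintype ι] {A B : Matrix ι ι ℂ}
    (hA : A.PosSemidef) (hB : B.PosSemidef) :
    ∑ i, ∑ j, ‖A i j‖ * ‖B i j‖ ≤ (∑ i, (A i i).re) * ∑ i, (B i i).re := by
  have hA' i : 0 ≤ (A i i).re := (Complex.nonneg_iff.1 (hA.diag_nonneg (i := i))).1
  have hB' i : 0 ≤ (B i i).re := (Complex.nonneg_iff.1 (hB.diag_nonneg (i := i))).1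
  calc ∑ i, ∑ j, ‖A i j‖ * ‖B i j‖
      ≤ ∑ i, ∑ j, (√(A i i).re * √(A j j).re) * (√(B i i).re * √(B j j).re) := by
        gcongr
        · exact hA.norm_apply_le_sqrt_mul_sqrt _ _
        · exact hB.norm_apply_le_sqrt_mul_sqrt _ _
    _ = (∑ i, √(A i i).re * √(B i i).re) ^ 2 := by
        rw [sq, Finset.sum_mul_sum]
        exact Finset.sum_congr rfl fun i _ => Finset.sum_congr rfl fun j _ => by ring
    _ ≤ (∑ i, √(A i i).re ^ 2) * ∑ i, √(B i i).re ^ 2 :=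
        Finset.sum_mul_sq_le_sq_mul_sq _ _ _
    _ = (∑ i, (A i i).re) * ∑ i, (B i i).re := by
        simp only [Real.sq_sqrt, hA', hB']

section Bell

variable {D : ℕ} [NeZero D]

/-- The generalised Bell basis of `ℂ^D ⊗ ℂ^D`, with both factors indexed by `ZMod D`. -/
noncomputable def bellVector (k : ZMod D × ZMod D) : ZMod D × ZMod D → ℂ :=
  fun p => if p.2 = p.1 + k.2 then ((√(D : ℝ))⁻¹ : ℝ) * ZMod.stdAddChar (k.1 * p.1) else 0

lemma inv_sqrt_mul_inv_sqrt_natCast (n : ℕ) : (√(n : ℝ))⁻¹ * (√(n : ℝ))⁻¹ = (n : ℝ)⁻¹ := by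
  rw [← mul_inv, Real.mul_self_sqrt n.cast_nonneg]

lemma bellVector_quadForm (k : ZMod D × ZMod D)
    (Y : Matrix (ZMod D × ZMod D) (ZMod D × ZMod D) ℂ) :
    star (bellVector k) ⬝ᵥ (Y *ᵥ bellVector k) =
      ((D : ℝ)⁻¹ : ℝ) * ∑ i, ∑ j, conj (ZMod.stdAddChar (k.1 * i)) *
        Y (i, i + k.2) (j, j + k.2) * ZMod.stdAddChar (k.1 * j) := by
  rw [← inv_sqrt_mul_inv_sqrt_natCast]
  simp only [dotProduct, mulVec, bellVector, Fintype.sum_prod_type, Pi.star_apply, apply_ite star,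
    star_zero, ite_mul, zero_mul, mul_ite, mul_zero, Finset.sum_ite_eq',
    Finset.mem_univ, if_true]
  simp only [Finset.mul_sum]
  refine Finset.sum_congr rfl fun i _ => Finset.sum_congr rfl fun j _ => ?_
  simp only [star_mul', Complex.star_def, Complex.conj_ofReal, Complex.ofReal_mul]
  ring

/-- The Bell basis is complete. -/
lemma sum_bellVector_mul_conj (p q : ZMod D × ZMod D) :
    ∑ k, bellVector k p * conj (bellVector k q) = if p = q then 1 else 0 := by
  have hD : (D : ℂ) ≠ 0 := Nat.cast_ne_zero.2 (NeZero.ne D)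
  have hterm (a b : ZMod D) : bellVector (a, b) p * conj (bellVector (a, b) q) =
      (if b = p.2 - p.1 then 1 else 0) * (if b = q.2 - q.1 then 1 else 0) *
        (((D : ℝ)⁻¹ : ℝ) * ZMod.stdAddChar (a * (p.1 - q.1))) := by
    have hp : p.2 = p.1 + b ↔ b = p.2 - p.1 := by
      rw [eq_sub_iff_add_eq, add_comm b, eq_comm]
    have hq : q.2 = q.1 + b ↔ b = q.2 - q.1 := by
      rw [eq_sub_iff_add_eq, add_comm b, eq_comm]
    simp only [bellVector, hp, hq, ← inv_sqrt_mul_inv_sqrt_natCast]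
    split_ifs
    · rw [mul_sub, sub_eq_add_neg, AddChar.map_add_eq_mul, AddChar.map_neg_eq_conj]
      simp only [map_mul, Complex.conj_ofReal, Complex.ofReal_mul]
      ring
    all_goals simp
  rw [Fintype.sum_prod_type]
  simp_rw [hterm]
  rw [Finset.sum_comm]
  simp_rw [← Finset.mul_sum, AddChar.sum_mulShift _ (ZMod.isPrimitive_stdAddChar D)]
  simp only [ite_mul, one_mul, zero_mul, Finset.sum_ite_eq', Finset.mem_univ, if_true, ZMod.card,
    sub_eq_zero]
  by_cases h : p = q
  · subst h
    simp [hD]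
  · rw [if_neg h]
    split_ifs with h1 h2
    · exact absurd (Prod.ext h2 (by simpa [h2] using h1)) h
    all_goals simp

lemma star_bellVector_dotProduct_self (k : ZMod D × ZMod D) :
    star (bellVector k) ⬝ᵥ bellVector k = 1 := by
  have hD : (D : ℂ) ≠ 0 := Nat.cast_ne_zero.2 (NeZero.ne D)
  have h := bellVector_quadForm k 1
  rw [one_mulVec] at h
  rw [h]
  simp [Matrix.one_apply, Complex.conj_mul', hD]

/-- A maximally entangled vector has overlap at most `1 / D` with a product operator. -/
lemma re_bellVector_quadForm_kronecker_le (k : ZMod D × ZMod D)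
    {A B : Matrix (ZMod D) (ZMod D) ℂ} (hA : A.PosSemidef) (hB : B.PosSemidef) :
    (star (bellVector k) ⬝ᵥ ((A ⊗ₖ B) *ᵥ bellVector k)).re ≤ (D : ℝ)⁻¹ * (A ⊗ₖ B).trace.re := by
  have htr : (A ⊗ₖ B).trace.re =
      (∑ i, (A i i).re) * ∑ i, ((B.submatrix (· + k.2) (· + k.2)) i i).re := by
    have hsum : ∑ i, ((B.submatrix (· + k.2) (· + k.2)) i i).re = ∑ i, (B i i).re :=
      Equiv.sum_comp (Equiv.addRight k.2) fun i => (B i i).re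
    have hA' : A.trace.im = 0 := (Complex.nonneg_iff.1 hA.trace_nonneg).2.symm
    rw [trace_kronecker, Complex.mul_re, hA', zero_mul, sub_zero, hsum]
    simp [trace]
  rw [bellVector_quadForm, Complex.re_ofReal_mul, htr]
  gcongr
  refine le_trans ?_ (hA.sum_norm_mul_norm_le (hB.submatrix (· + k.2)))
  refine (Complex.re_le_norm _).trans ((norm_sum_le _ _).trans ?_)
  refine Finset.sum_le_sum fun i _ => (norm_sum_le _ _).trans (Finset.sum_le_sum fun j _ => ?_)
  simp

lemma re_bellVector_quadForm_submatrix_le {dA dB : ℕ} (f : ZMod D → Fin dA) (g : ZMod D → Fin dB)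
    (k : ZMod D × ZMod D) {X : Matrix (Fin dA × Fin dB) (Fin dA × Fin dB) ℂ} (hX : IsSepMat X) :
    (star (bellVector k) ⬝ᵥ (X.submatrix (Prod.map f g) (Prod.map f g) *ᵥ bellVector k)).re ≤
      (D : ℝ)⁻¹ * (X.submatrix (Prod.map f g) (Prod.map f g)).trace.re := by
  obtain ⟨n, A, B, hA, hB, rfl⟩ := hX
  have hsub : (∑ i, A i ⊗ₖ B i).submatrix (Prod.map f g) (Prod.map f g) =
      ∑ i, (A i).submatrix f f ⊗ₖ (B i).submatrix g g := by
    ext p q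
    simp [Matrix.sum_apply]
  rw [hsub, sum_mulVec, dotProduct_sum, trace_sum, Complex.re_sum, Complex.re_sum, Finset.mul_sum]
  exact Finset.sum_le_sum fun i _ =>
    re_bellVector_quadForm_kronecker_le k ((hA i).submatrix f) ((hB i).submatrix g)

/-- The Bell measurement on the image of an embedding `e`, completed by an equal share of the
projection onto the complementary coordinates. -/
noncomputable def bellEffect {ι : Type*} [DecidableEq ι] (e : ZMod D × ZMod D → ι)
    (k : ZMod D × ZMod D) : Matrix ι ι ℂ :=
  vecMulVec (Function.extend e (bellVector k) 0) (star (Function.extend e (bellVector k) 0)) +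
    diagonal ((Set.range e)ᶜ.indicator fun _ => ((D : ℂ) * D)⁻¹)

variable {ι : Type*} [DecidableEq ι] {e : ZMod D × ZMod D → ι}

lemma bellEffect_submatrix (he : e.Injective) (k : ZMod D × ZMod D) :
    (bellEffect e k).submatrix e e = vecMulVec (bellVector k) (star (bellVector k)) := by
  ext p q
  simp [bellEffect, vecMulVec_apply, he.extend_apply, diagonal_apply]

lemma isPOVM_bellEffect [Fintype ι] (he : e.Injective) : IsPOVM (bellEffect e) := by
  classical
  have hD : (D : ℂ) ≠ 0 := Nat.cast_ne_zero.2 (NeZero.ne D)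
  refine ⟨fun k => (posSemidef_vecMulVec_self_star _).add (.diagonal fun i => ?_), ?_⟩
  · refine Set.indicator_nonneg (fun _ _ => ?_) i
    positivity
  ext p q
  simp only [bellEffect, Matrix.sum_apply, Matrix.add_apply, vecMulVec_apply, Pi.star_apply,
    Complex.star_def, Finset.sum_add_distrib]
  by_cases hp : p ∈ Set.range e
  · obtain ⟨p, rfl⟩ := hp
    by_cases hq : q ∈ Set.range e
    · obtain ⟨q, rfl⟩ := hq
      simp [he.extend_apply, sum_bellVector_mul_conj, diagonal_apply, one_apply, he.eq_iff]
    · have hne : e p ≠ q := fun h => hq ⟨p, h⟩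
      simp [Function.extend_apply' _ _ _ hq, hne]
  · by_cases hpq : p = q
    · subst hpq
      simp [Function.extend_apply' _ _ _ hp, Set.indicator_of_mem (Set.mem_compl hp)]
      field_simp
    · simp [Function.extend_apply' _ _ _ hp, hpq]

end Bell

lemma IsPOVM.comp_equiv {ι κ κ' : Type*} [Fintype ι] [DecidableEq ι] [Fintype κ] [Fintype κ']
    {M : κ → Matrix ι ι ℂ} (hM : IsPOVM M) (σ : κ' ≃ κ) : IsPOVM (M ∘ σ) :=
  ⟨fun k => hM.1 (σ k), (Equiv.sum_comp σ M).trans hM.2⟩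

lemma isSepMat_smul_one {dA dB : ℕ} {c : ℝ} (hc : 0 ≤ c) :
    IsSepMat (c • (1 : Matrix (Fin dA × Fin dB) (Fin dA × Fin dB) ℂ)) := by
  refine ⟨1, fun _ => c • 1, fun _ => 1, fun _ => PosSemidef.one.smul hc, fun _ => .one, ?_⟩
  simp [smul_kronecker]

/-- Mixing a POVM with its normalised complement gives the uniform POVM, which is separable. -/
lemma IsPOVM.sub_one_mem_robustnessSet {dA dB m : ℕ}
    {M : Fin m → Matrix (Fin dA × Fin dB) (Fin dA × Fin dB) ℂ} (hM : IsPOVM M) (hm : 2 ≤ m) :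
    (m - 1 : ℝ) ∈ robustnessSet (SepPOVM dA dB m) M := by
  have hm' : (0 : ℝ) < m - 1 := by
    have : (2 : ℝ) ≤ m := by exact_mod_cast hm
    linarith
  have hm0 : (m : ℝ) ≠ 0 := by positivity
  have hmix : (fun k => (1 + (m - 1 : ℝ))⁻¹ • (M k + (m - 1 : ℝ) • ((m - 1 : ℝ)⁻¹ • (1 - M k)))) =
      fun _ => (m : ℝ)⁻¹ • 1 := by
    funext k
    rw [smul_inv_smul₀ hm'.ne', add_sub_cancel, add_sub_cancel]
  refine ⟨hm'.le, fun k => (m - 1 : ℝ)⁻¹ • (1 - M k), ⟨fun k => ?_, ?_⟩, ?_⟩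
  · refine PosSemidef.smul ?_ (inv_nonneg.2 hm'.le)
    rw [← hM.2, ← Finset.add_sum_erase _ _ (Finset.mem_univ k), add_sub_cancel_left]
    exact posSemidef_sum _ fun j _ => hM.1 j
  · rw [← Finset.smul_sum, Finset.sum_sub_distrib, hM.2, Finset.sum_const, Finset.card_univ,
      Fintype.card_fin, ← Nat.cast_smul_eq_nsmul ℝ]
    nth_rewrite 2 [← one_smul ℝ (1 : Matrix (Fin dA × Fin dB) (Fin dA × Fin dB) ℂ)]
    rw [← sub_smul, inv_smul_smul₀ hm'.ne']
  · rw [hmix]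
    refine ⟨⟨fun _ => PosSemidef.one.smul (by positivity), ?_⟩,
      fun _ => isSepMat_smul_one (by positivity)⟩
    rw [Finset.sum_const, Finset.card_univ, Fintype.card_fin, ← Nat.cast_smul_eq_nsmul ℝ,
      smul_inv_smul₀ hm0]

lemma sub_one_le_of_mem_robustnessSet_bellEffect {D dA dB m : ℕ} [NeZero D]
    {f : ZMod D → Fin dA} {g : ZMod D → Fin dB} (hf : f.Injective) (hg : g.Injective)
    (σ : Fin m ≃ ZMod D × ZMod D) {s : ℝ}
    (hs : s ∈ robustnessSet (SepPOVM dA dB m) (bellEffect (Prod.map f g) ∘ σ)) :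
    (D : ℝ) - 1 ≤ s := by
  obtain ⟨hs0, N, hN, hX, hsep⟩ := hs
  set X := fun k => (1 + s)⁻¹ • ((bellEffect (Prod.map f g) ∘ σ) k + s • N k)
  have he : (Prod.map f g).Injective := hf.prodMap hg
  have hD : (0 : ℝ) < D := Nat.cast_pos.2 (NeZero.pos D)
  have hlower (k : Fin m) : (1 + s)⁻¹ ≤ (star (bellVector (σ k)) ⬝ᵥ
      ((X k).submatrix (Prod.map f g) (Prod.map f g) *ᵥ bellVector (σ k))).re := by
    have hsub : (X k).submatrix (Prod.map f g) (Prod.map f g) = (1 + s)⁻¹ •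
        (vecMulVec (bellVector (σ k)) (star (bellVector (σ k))) +
          s • (N k).submatrix (Prod.map f g) (Prod.map f g)) := by
      rw [← bellEffect_submatrix he]
      rfl
    have hnn := (Complex.nonneg_iff.1
      (((hN.1 k).submatrix (Prod.map f g)).dotProduct_mulVec_nonneg (bellVector (σ k)))).1
    rw [hsub, smul_mulVec, add_mulVec, smul_mulVec, vecMulVec_mulVec,
      star_bellVector_dotProduct_self, MulOpposite.op_one, one_smul, dotProduct_smul,
      dotProduct_add, dotProduct_smul, star_bellVector_dotProduct_self, Complex.smul_re,
      Complex.add_re, Complex.smul_re, Complex.one_re, smul_eq_mul, smul_eq_mul]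
    exact le_mul_of_one_le_right (by positivity) (le_add_of_nonneg_right (mul_nonneg hs0 hnn))
  have htrace : ∑ k, ((X k).submatrix (Prod.map f g) (Prod.map f g)).trace.re = D * D := by
    rw [← Complex.re_sum, ← trace_sum]
    have hsum : ∑ k, (X k).submatrix (Prod.map f g) (Prod.map f g) = 1 := by
      rw [← submatrix_one _ he, ← hX.2]
      ext p q
      simp [Matrix.sum_apply]
    rw [hsum, trace_one, Fintype.card_prod, ZMod.card]
    simp
  have hcard : (m : ℝ) = D * D := by
    have := Fintype.card_congr σ
    rw [Fintype.card_fin, Fintype.card_prod, ZMod.card] at this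
    exact_mod_cast this
  have hmain : (D * D : ℝ) * (1 + s)⁻¹ ≤ D :=
    calc (D * D : ℝ) * (1 + s)⁻¹ = ∑ _k : Fin m, (1 + s)⁻¹ := by simp [hcard]
      _ ≤ ∑ k, (D : ℝ)⁻¹ * ((X k).submatrix (Prod.map f g) (Prod.map f g)).trace.re :=
        Finset.sum_le_sum fun k _ =>
          (hlower k).trans (re_bellVector_quadForm_submatrix_le f g (σ k) (hsep k))
      _ = D := by
        rw [← Finset.mul_sum, htrace]
        field_simp
  rw [← div_eq_mul_inv, div_le_iff₀ (by positivity)] at hmain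
  linarith [le_of_mul_le_mul_left hmain hD]

/-- There is a `D²`-outcome POVM on `ℂ^{d_A} ⊗ ℂ^{d_B}` whose robustness with respect to
separable POVMs is at least `D − 1`, where `D = min{d_A, d_B}`. -/
theorem exists_povm_robustness_sep_ge {dA dB : ℕ} (hA : 1 ≤ dA) (hB : 1 ≤ dB) :
    ∃ M : Fin (min dA dB * min dA dB) → Matrix (Fin dA × Fin dB) (Fin dA × Fin dB) ℂ,
      IsPOVM M ∧
      (min dA dB : ℝ) - 1 ≤ robustness (SepPOVM dA dB (min dA dB * min dA dB)) M := by
  have : NeZero (min dA dB) := ⟨(lt_min hA hB).ne'⟩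
  have hcast : (min dA dB : ℝ) = ((min dA dB : ℕ) : ℝ) := (Nat.cast_min dA dB).symm
  rw [hcast]
  generalize hD : min dA dB = D at *
  let ε : ZMod D ≃ Fin D := (ZMod.finEquiv D).symm.toEquiv
  let f : ZMod D → Fin dA := Fin.castLE (hD ▸ min_le_left dA dB) ∘ ε
  let g : ZMod D → Fin dB := Fin.castLE (hD ▸ min_le_right dA dB) ∘ ε
  have hf : f.Injective := (Fin.castLE_injective _).comp ε.injective
  have hg : g.Injective := (Fin.castLE_injective _).comp ε.injective
  let σ : Fin (D * D) ≃ ZMod D × ZMod D := finProdFinEquiv.symm.trans (ε.symm.prodCongr ε.symm)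
  have hM : IsPOVM (bellEffect (Prod.map f g) ∘ σ) :=
    (isPOVM_bellEffect (hf.prodMap hg)).comp_equiv σ
  refine ⟨_, hM, ?_⟩
  rcases (NeZero.one_le (n := D)).eq_or_lt with h1 | h1
  · have h0 : (D : ℝ) - 1 = 0 := by rw [← h1, Nat.cast_one, sub_self]
    rw [h0]
    exact Real.sInf_nonneg fun s hs => hs.1
  · exact le_csInf ⟨_, hM.sub_one_mem_robustnessSet (by nlinarith)⟩ fun s hs =>
      sub_one_le_of_mem_robustnessSet_bellEffect hf hg σ hs
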